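/- arXiv:2007.11781 — 6 statements merged into one kernel-verified Lean document; each statement's English description precedes it below -/
import Mathlib

section
/- Let N ≥ 2 be an integer and θ₁,…,θ_N real numbers with 0 ≤ θᵢ ≤ 1 for every i, and let A be the relative-concern matrix. Then for every row index i, the i-th absolute row sum of A equals (N−1)·θᵢ/(N−θᵢ) and is at most max_k θ_k, and for every column index j, the j-th absolute column sum Σ_{i≠j} θᵢ/(N−θᵢ) is at most max_k θ_k. Consequently both the induced ℓ∞→ℓ∞ operator norm and the induced ℓ¹→ℓ¹ operator norm of A are at most max_k θ_k. -/
namespace Matrix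

variable {m n : Type*} [Fintype n]

theorem abs_mulVec_le_of_row_sum_le (A : Matrix m n ℝ) (x : n → ℝ) {i : m} {c b : ℝ}
    (hA : ∑ j, |A i j| ≤ c) (hb : 0 ≤ b) (hx : ∀ j, |x j| ≤ b) : |A.mulVec x i| ≤ c * b :=
  calc |A.mulVec x i| ≤ ∑ j, |A i j * x j| := Finset.abs_sum_le_sum_abs _ _
    _ ≤ ∑ j, |A i j| * b := by
      gcongr with j
      rw [abs_mul]
      exact mul_le_mul_of_nonneg_left (hx j) (abs_nonneg _)
    _ = (∑ j, |A i j|) * b := (Finset.sum_mul ..).symm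
    _ ≤ c * b := by gcongr

theorem sum_abs_mulVec_le_of_col_sum_le [Fintype m] (A : Matrix m n ℝ) (x : n → ℝ) {c : ℝ}
    (hA : ∀ j, ∑ i, |A i j| ≤ c) : ∑ i, |A.mulVec x i| ≤ c * ∑ j, |x j| :=
  calc
    ∑ i, |A.mulVec x i| ≤ ∑ i, ∑ j, |A i j * x j| := by
      gcongr with i
      exact Finset.abs_sum_le_sum_abs _ _
    _ = ∑ j, (∑ i, |A i j|) * |x j| := by
      rw [Finset.sum_comm]
      simp only [abs_mul, Finset.sum_mul]
    _ ≤ ∑ j, c * |x j| := by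
      gcongr with j
      exact hA j
    _ = c * ∑ j, |x j| := (Finset.mul_sum ..).symm

end Matrix

theorem Fin.sum_erase_le_of_le_div {N : ℕ} (hN : 2 ≤ N) (j : Fin N) {f : Fin N → ℝ} {c : ℝ}
    (hf : ∀ i, f i ≤ c / ((N : ℝ) - 1)) : ∑ i ∈ Finset.univ.erase j, f i ≤ c := by
  have hN' : (2 : ℝ) ≤ N := by exact_mod_cast hN
  have h := Finset.sum_le_card_nsmul (Finset.univ.erase j) f _ fun i _ ↦ hf i
  rwa [Finset.card_erase_of_mem (Finset.mem_univ j), Finset.card_univ, Fintype.card_fin,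
    nsmul_eq_mul, Nat.cast_sub (by omega), Nat.cast_one,
    mul_div_cancel₀ _ (sub_pos.2 (by linarith : (1 : ℝ) < N)).ne'] at h


/-- For the relative-concern matrix `A` (zero diagonal, off-diagonal
entries `θ i / (N - θ i)`), every absolute row sum equals `(N-1)·θ i/(N-θ i)` and is at
most `max_k θ k`; every absolute column sum equals `∑_{i ≠ j} θ i/(N-θ i)` and is at most
`max_k θ k`; consequently the induced `ℓ∞→ℓ∞` and `ℓ¹→ℓ¹` operator norms of `A` are at
most `max_k θ k`. -/
theorem stmt_0 (N : ℕ) (hN : 2 ≤ N) (θ : Fin N → ℝ)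
    (hθ : ∀ i, 0 ≤ θ i ∧ θ i ≤ 1)
    (A : Matrix (Fin N) (Fin N) ℝ)
    (hdiag : ∀ i, A i i = 0)
    (hoff : ∀ i j, i ≠ j → A i j = θ i / ((N : ℝ) - θ i)) :
    (∀ i, ∑ j, |A i j| = ((N : ℝ) - 1) * θ i / ((N : ℝ) - θ i) ∧
      ∑ j, |A i j| ≤ Finset.univ.sup' ⟨⟨0, by omega⟩, Finset.mem_univ _⟩ θ) ∧
    (∀ j, ∑ i, |A i j| = ∑ i ∈ Finset.univ.erase j, θ i / ((N : ℝ) - θ i) ∧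
      ∑ i, |A i j| ≤ Finset.univ.sup' ⟨⟨0, by omega⟩, Finset.mem_univ _⟩ θ) ∧
    (∀ x : Fin N → ℝ, ∀ i, |A.mulVec x i| ≤
      (Finset.univ.sup' ⟨⟨0, by omega⟩, Finset.mem_univ _⟩ θ) *
        Finset.univ.sup' ⟨⟨0, by omega⟩, Finset.mem_univ _⟩ (fun j => |x j|)) ∧
    (∀ x : Fin N → ℝ, ∑ i, |A.mulVec x i| ≤
      (Finset.univ.sup' ⟨⟨0, by omega⟩, Finset.mem_univ _⟩ θ) * ∑ j, |x j|) := by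
  have hN' : (2 : ℝ) ≤ N := by exact_mod_cast hN
  set M := Finset.univ.sup' ⟨⟨0, by omega⟩, Finset.mem_univ _⟩ θ
  have hM i : θ i ≤ M := Finset.le_sup' θ (Finset.mem_univ i)
  have hnn i : 0 ≤ θ i / ((N : ℝ) - θ i) := div_nonneg (hθ i).1 (by linarith [(hθ i).2])
  have hle i : θ i / ((N : ℝ) - θ i) ≤ M / ((N : ℝ) - 1) :=
    div_le_div₀ ((hθ i).1.trans (hM i)) (hM i) (by linarith) (by linarith [(hθ i).2])
  have habs i j (hij : i ≠ j) : |A i j| = θ i / ((N : ℝ) - θ i) := by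
    rw [hoff i j hij, abs_of_nonneg (hnn i)]
  have hrow i : ∑ j, |A i j| = ∑ j ∈ Finset.univ.erase i, θ i / ((N : ℝ) - θ i) := by
    rw [← Finset.sum_erase Finset.univ (a := i) (by simp [hdiag])]
    exact Finset.sum_congr rfl fun j hj ↦ habs i j (Finset.ne_of_mem_erase hj).symm
  have hcol j : ∑ i, |A i j| = ∑ i ∈ Finset.univ.erase j, θ i / ((N : ℝ) - θ i) := by
    rw [← Finset.sum_erase Finset.univ (a := j) (by simp [hdiag])]
    exact Finset.sum_congr rfl fun i hi ↦ habs i j (Finset.ne_of_mem_erase hi)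
  have hrow_le i : ∑ j, |A i j| ≤ M :=
    (hrow i).trans_le (Fin.sum_erase_le_of_le_div hN i fun _ ↦ hle i)
  have hcol_le j : ∑ i, |A i j| ≤ M :=
    (hcol j).trans_le (Fin.sum_erase_le_of_le_div hN j hle)
  refine ⟨fun i ↦ ⟨?_, hrow_le i⟩, fun j ↦ ⟨hcol j, hcol_le j⟩, fun x i ↦ ?_,
    fun x ↦ A.sum_abs_mulVec_le_of_col_sum_le x hcol_le⟩
  · rw [hrow i, Finset.sum_const, Finset.card_erase_of_mem (Finset.mem_univ i),
      Finset.card_univ, Fintype.card_fin, nsmul_eq_mul, Nat.cast_sub (by omega), Nat.cast_one,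
      mul_div_assoc]
  · have hx j := Finset.le_sup' (fun j ↦ |x j|) (Finset.mem_univ j)
    exact A.abs_mulVec_le_of_row_sum_le x (hrow_le i) ((abs_nonneg _).trans (hx i)) hx
end

section
/- Let N ≥ 2 be an integer and θ₁,…,θ_N real numbers with 0 ≤ θᵢ ≤ 1 for every i, let A be the relative-concern matrix, and let L_a = sup{‖Ax‖₂ : x ∈ ℝᴺ, ‖x‖₂ = 1} be its ℓ²→ℓ² operator norm. Then L_a ≤ max_k θ_k. In particular, if max_k θ_k < e^{−1/2} (where e is Euler's number), then L_a² · e < 1, i.e. the competition-parameter condition of the paper holds. -/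
/-- The matrix with zero diagonal and all other entries `1` has `ℓ²` operator norm at most
`card ι - 1`. -/
theorem sum_sq_sum_sub_le {ι : Type*} [Fintype ι] (hι : 2 ≤ Fintype.card ι) (x : ι → ℝ) :
    ∑ i, ((∑ j, x j) - x i) ^ 2 ≤ ((Fintype.card ι : ℝ) - 1) ^ 2 * ∑ i, x i ^ 2 := by
  have hcard : (2 : ℝ) ≤ Fintype.card ι := by exact_mod_cast hι
  have hexpand : ∑ i, ((∑ j, x j) - x i) ^ 2
      = ((Fintype.card ι : ℝ) - 2) * (∑ j, x j) ^ 2 + ∑ i, x i ^ 2 := by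
    simp only [sub_sq, Finset.sum_add_distrib, Finset.sum_sub_distrib, ← Finset.mul_sum,
      Finset.sum_const, Finset.card_univ, nsmul_eq_mul]
    ring
  have hcs : (∑ j, x j) ^ 2 ≤ (Fintype.card ι : ℝ) * ∑ j, x j ^ 2 :=
    sq_sum_le_card_mul_sum_sq
  rw [hexpand]
  linear_combination mul_le_mul_of_nonneg_left hcs (sub_nonneg.2 hcard)

/-- If the rows of `A` are constant off the diagonal, vanish on it, and the row constants are
bounded by `c`, then `A` has `ℓ²` operator norm at most `c * (card ι - 1)`. -/
theorem norm_toEuclideanCLM_le_of_offDiag_const {ι : Type*} [Fintype ι] [DecidableEq ι]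
    (hι : 2 ≤ Fintype.card ι) (A : Matrix ι ι ℝ) (d : ι → ℝ) (c : ℝ) (hc : 0 ≤ c)
    (hd : ∀ i, |d i| ≤ c) (hdiag : ∀ i, A i i = 0) (hoff : ∀ i j, i ≠ j → A i j = d i) :
    ‖Matrix.toEuclideanCLM (𝕜 := ℝ) A‖ ≤ c * ((Fintype.card ι : ℝ) - 1) := by
  have hcard : (2 : ℝ) ≤ Fintype.card ι := by exact_mod_cast hι
  have hbound : 0 ≤ c * ((Fintype.card ι : ℝ) - 1) := mul_nonneg hc (by linarith)
  refine ContinuousLinearMap.opNorm_le_bound _ hbound fun x => ?_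
  refine le_of_sq_le_sq ?_ (mul_nonneg hbound (norm_nonneg x))
  have hrow (i : ι) : Matrix.toEuclideanCLM (𝕜 := ℝ) A x i = d i * ((∑ j, x j) - x i) := by
    rw [Matrix.ofLp_toEuclideanCLM, Matrix.mulVec, dotProduct,
      ← Finset.add_sum_erase _ _ (Finset.mem_univ i),
      ← Finset.add_sum_erase _ x.ofLp (Finset.mem_univ i), hdiag, zero_mul, zero_add,
      add_sub_cancel_left, Finset.mul_sum]
    exact Finset.sum_congr rfl fun j hj => by rw [hoff i j (Finset.ne_of_mem_erase hj).symm]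
  rw [mul_pow, EuclideanSpace.real_norm_sq_eq, EuclideanSpace.real_norm_sq_eq]
  calc ∑ i, Matrix.toEuclideanCLM (𝕜 := ℝ) A x i ^ 2
      ≤ ∑ i, c ^ 2 * ((∑ j, x j) - x i) ^ 2 := by
        refine Finset.sum_le_sum fun i _ => ?_
        rw [hrow, mul_pow]
        exact mul_le_mul_of_nonneg_right (sq_le_sq.2 ((hd i).trans (le_abs_self c)))
          (sq_nonneg _)
    _ ≤ (c * ((Fintype.card ι : ℝ) - 1)) ^ 2 * ∑ i, x i ^ 2 := by
        rw [← Finset.mul_sum, mul_pow, mul_assoc]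
        exact mul_le_mul_of_nonneg_left (sum_sq_sum_sub_le hι x) (sq_nonneg c)

/-- For the relative-concern matrix `A`, its `ℓ²→ℓ²` operator norm
`L_a = sup {‖Ax‖₂ : ‖x‖₂ = 1}` satisfies `L_a ≤ max_k θ k`; in particular, if
`max_k θ k < e^{-1/2}` then `L_a² · e < 1` (the competition-parameter condition). -/
theorem stmt_2 (N : ℕ) (hN : 2 ≤ N) (θ : Fin N → ℝ)
    (hθ : ∀ i, 0 ≤ θ i ∧ θ i ≤ 1)
    (A : Matrix (Fin N) (Fin N) ℝ)
    (hdiag : ∀ i, A i i = 0)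
    (hoff : ∀ i j, i ≠ j → A i j = θ i / ((N : ℝ) - θ i))
    (La : ℝ) (hLa : La = ‖Matrix.toEuclideanCLM (𝕜 := ℝ) A‖) :
    La ≤ Finset.univ.sup' ⟨⟨0, by omega⟩, Finset.mem_univ _⟩ θ ∧
      (Finset.univ.sup' ⟨⟨0, by omega⟩, Finset.mem_univ _⟩ θ < Real.exp (-(1/2)) →
        La ^ 2 * Real.exp 1 < 1) := by
  have hN' : (2 : ℝ) ≤ N := by exact_mod_cast hN
  set M := Finset.univ.sup' ⟨⟨0, by omega⟩, Finset.mem_univ _⟩ θ with hM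
  have hle (i : Fin N) : θ i ≤ M := Finset.le_sup' θ (Finset.mem_univ i)
  have hM0 : 0 ≤ M := (hθ ⟨0, by omega⟩).1.trans (hle _)
  have hLaM : La ≤ M := by
    have hnorm := norm_toEuclideanCLM_le_of_offDiag_const (by simpa using hN) A
      (fun i => θ i / ((N : ℝ) - θ i)) (M / ((N : ℝ) - 1)) (div_nonneg hM0 (by linarith))
      (fun i => by
        obtain ⟨h0, h1⟩ := hθ i
        rw [abs_of_nonneg (div_nonneg h0 (by linarith))]
        exact div_le_div₀ hM0 (hle i) (by linarith) (by linarith)) hdiag hoff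
    rwa [← hLa, Fintype.card_fin, div_mul_cancel₀ _ (by linarith)] at hnorm
  refine ⟨hLaM, fun hlt => ?_⟩
  have hLa0 : 0 ≤ La := hLa ▸ norm_nonneg _
  calc La ^ 2 * Real.exp 1
      < Real.exp (-(1 / 2)) ^ 2 * Real.exp 1 :=
        mul_lt_mul_of_pos_right (pow_lt_pow_left₀ (hLaM.trans_lt hlt) hLa0 two_ne_zero)
          (Real.exp_pos 1)
    _ = 1 := by
        rw [← Real.exp_nat_mul, ← Real.exp_add]
        norm_num
end

section
/- Let λ ∈ ℝ, σ_S > 0, σ_μ > 0, ρ ∈ (−1, 1), and Σ₀ ≥ 0. Set k = λ²σ_S² + 2σ_Sσ_μλρ + σ_μ², k₁ = √k·σ_S + λσ_S² + σ_Sσ_μρ + Σ₀, k₂ = −√k·σ_S + λσ_S² + σ_Sσ_μρ + Σ₀, and define Σ̂(t) = √k·σ_S·(k₁e^{2√k t/σ_S} + k₂)/(k₁e^{2√k t/σ_S} − k₂) − (λ + σ_μρ/σ_S)σ_S². Then k > 0, the denominator k₁e^{2√k t/σ_S} − k₂ is strictly positive for every t ≥ 0, Σ̂(0) = Σ₀,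 and for every t ≥ 0 the function Σ̂ is differentiable at t with derivative Σ̂'(t) = σ_μ² − 2λΣ̂(t) − (Σ̂(t) + σ_Sσ_μρ)²/σ_S². -/
/-- The closed-form conditional variance `Shat` of the Kalman–Bucy filter:
`k > 0`, the denominator `k₁ e^{2√k t/σ_S} - k₂` is positive for `t ≥ 0`, `Shat 0 = Σ₀`,
and `Shat` solves the Riccati ODE
`Shat'(t) = σ_μ² - 2λ·Shat(t) - (Shat(t) + σ_S σ_μ ρ)²/σ_S²` for every `t ≥ 0`. -/
theorem stmt_3 (lam σS σμ ρ S0 : ℝ) (hσS : 0 < σS) (hσμ : 0 < σμ)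
    (hρ : -1 < ρ ∧ ρ < 1) (hS0 : 0 ≤ S0)
    (k k1 k2 : ℝ)
    (hk : k = lam ^ 2 * σS ^ 2 + 2 * σS * σμ * lam * ρ + σμ ^ 2)
    (hk1 : k1 = Real.sqrt k * σS + lam * σS ^ 2 + σS * σμ * ρ + S0)
    (hk2 : k2 = -(Real.sqrt k * σS) + lam * σS ^ 2 + σS * σμ * ρ + S0)
    (Shat : ℝ → ℝ)
    (hS : ∀ t, Shat t = Real.sqrt k * σS *
        (k1 * Real.exp (2 * Real.sqrt k / σS * t) + k2) /
        (k1 * Real.exp (2 * Real.sqrt k / σS * t) - k2) -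
        (lam + σμ * ρ / σS) * σS ^ 2) :
    0 < k ∧
    (∀ t : ℝ, 0 ≤ t → 0 < k1 * Real.exp (2 * Real.sqrt k / σS * t) - k2) ∧
    Shat 0 = S0 ∧
    (∀ t : ℝ, 0 ≤ t → HasDerivAt Shat
      (σμ ^ 2 - 2 * lam * Shat t - (Shat t + σS * σμ * ρ) ^ 2 / σS ^ 2) t) := by
  obtain ⟨hρ1, hρ2⟩ := hρ
  have hgap : (lam * σS + σμ * ρ) ^ 2 < k := by
    have : 0 < σμ ^ 2 * ((1 - ρ) * (1 + ρ)) :=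
      mul_pos (pow_pos hσμ 2) (mul_pos (by linarith) (by linarith))
    rw [hk]
    linarith
  have hk0 : 0 < k := (sq_nonneg _).trans_lt hgap
  have habs : |lam * σS + σμ * ρ| < √k := Real.lt_sqrt_of_sq_lt (by rwa [sq_abs])
  have hsq : √k ^ 2 = k := Real.sq_sqrt hk0.le
  have hs : 0 < √k := Real.sqrt_pos.2 hk0
  generalize √k = s at *
  have hk1pos : 0 < k1 := by
    have : 0 < σS * (s + (lam * σS + σμ * ρ)) :=
      mul_pos hσS (by linarith [neg_abs_le (lam * σS + σμ * ρ)])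
    rw [hk1]
    linarith
  have hdiff : k1 - k2 = 2 * (s * σS) := by rw [hk1, hk2]; ring
  have hden : ∀ t : ℝ, 0 ≤ t → 0 < k1 * Real.exp (2 * s / σS * t) - k2 := by
    intro t ht
    have hE : 1 ≤ Real.exp (2 * s / σS * t) := Real.one_le_exp (by positivity)
    linarith [mul_le_mul_of_nonneg_left hE hk1pos.le, mul_pos hs hσS]
  refine ⟨hk0, hden, ?_, fun t ht => ?_⟩
  · have hsum : k1 + k2 = 2 * (lam * σS ^ 2 + σS * σμ * ρ + S0) := by rw [hk1, hk2]; ring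
    rw [hS, mul_zero, Real.exp_zero, mul_one, hdiff, hsum]
    field_simp
    ring
  · have hD := (hden t ht).ne'
    have hE : HasDerivAt (fun t => k1 * Real.exp (2 * s / σS * t))
        (k1 * (Real.exp (2 * s / σS * t) * (2 * s / σS))) t := by
      simpa using (((hasDerivAt_id t).const_mul (2 * s / σS)).exp).const_mul k1
    have hF := ((((hE.add_const k2).const_mul (s * σS)).div (hE.sub_const k2) hD).sub_const
      ((lam + σμ * ρ / σS) * σS ^ 2))
    rw [funext hS]
    refine hF.congr_deriv ?_
    have hμ : σμ ^ 2 = s ^ 2 - lam ^ 2 * σS ^ 2 - 2 * σS * σμ * lam * ρ := by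
      rw [hsq, hk]; ring
    rw [hμ]
    beta_reduce
    clear hF hE hk1 hk2 hS hden hμ
    generalize Real.exp (2 * s / σS * t) = E at *
    field_simp
    ring
end

section
/- Fix σ_S > 0, real constants λ, σ_μ, ρ, μ̄, w₂, continuous functions Σ̂, α : ℝ → ℝ, and s ∈ ℝ; write c₀ = σ_Sσ_μρ. Define A(t, s) = −(1/(2σ_S²)) · exp(−2∫ₜˢ (λ + (Σ̂(u) + c₀)/σ_S) du), l(t, s) = −(1/σ_S²) ∫ₜˢ (λμ̄ + w₂α(u)(Σ̂(u) + c₀)) · exp(−∫ᵤˢ (λ + 2(Σ̂(m) + c₀)/σ_S − (Σ̂(m) + c₀)/σ_S²) dm) du, and B(t, s) = l(t, s) · exp(−∫ₜˢ (λ + (Σ̂(u) + c₀)/σ_S²) du). Then B(s, s) = 0, and for every t ∈ ℝ the map t ↦ B(t, s) is differentiable with ∂ₜB(t, s) − λB(t, s) − ((Σ̂(t) + c₀)/σ_S²)·B(t, s) + 2λμ̄·A(t, s) + 2w₂α(t)(Σ̂(t) + c₀)·A(t, s) = 0. -/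
/-- The integral of a continuous function, as a function of its lower limit, has derivative the
negative of the integrand. -/
lemma hasDerivAt_integral_lower {f : ℝ → ℝ} (hf : Continuous f) (s t : ℝ) :
    HasDerivAt (fun x => ∫ u in x..s, f u) (-f t) t :=
  intervalIntegral.integral_hasDerivAt_left (hf.intervalIntegrable t s)
    hf.stronglyMeasurable.stronglyMeasurableAtFilter hf.continuousAt

lemma continuous_integral_lower {f : ℝ → ℝ} (hf : Continuous f) (s : ℝ) :
    Continuous fun x => ∫ u in x..s, f u :=
  continuous_iff_continuousAt.2 fun t => (hasDerivAt_integral_lower hf s t).continuousAt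

/-- With `A(t)` the explicit solution of the first coefficient ODE,
the explicit coefficient `B(t) = l(t)·exp(-∫ₜˢ (λ + (Σ̂(u)+c₀)/σ_S²) du)` satisfies
`B(s) = 0` and the linear ODE
`B'(t) - λB(t) - ((Σ̂(t)+c₀)/σ_S²)B(t) + 2λμ̄A(t) + 2w₂α(t)(Σ̂(t)+c₀)A(t) = 0`
at every `t ∈ ℝ` (terminal time `s` fixed). -/
theorem stmt_5 (σS lam σμ ρ mubar w2 : ℝ) (hσS : 0 < σS)
    (Shat α : ℝ → ℝ) (hShat : Continuous Shat) (hα : Continuous α) (s : ℝ)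
    (c0 : ℝ) (hc0 : c0 = σS * σμ * ρ)
    (A l B : ℝ → ℝ)
    (hA : ∀ t, A t = -(1 / (2 * σS ^ 2)) *
        Real.exp (-2 * ∫ u in t..s, (lam + (Shat u + c0) / σS)))
    (hl : ∀ t, l t = -(1 / σS ^ 2) * ∫ u in t..s,
        (lam * mubar + w2 * α u * (Shat u + c0)) *
          Real.exp (-(∫ m in u..s,
            (lam + 2 * (Shat m + c0) / σS - (Shat m + c0) / σS ^ 2))))
    (hB : ∀ t, B t = l t * Real.exp (-(∫ u in t..s, (lam + (Shat u + c0) / σS ^ 2)))) :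
    B s = 0 ∧
    ∀ t : ℝ, HasDerivAt B
      (lam * B t + ((Shat t + c0) / σS ^ 2) * B t - 2 * lam * mubar * A t
        - 2 * w2 * α t * (Shat t + c0) * A t) t := by
  have hp : Continuous fun u => lam + (Shat u + c0) / σS ^ 2 := by fun_prop
  have hq : Continuous fun m => lam + 2 * (Shat m + c0) / σS - (Shat m + c0) / σS ^ 2 := by
    fun_prop
  have hg : Continuous fun u => (lam * mubar + w2 * α u * (Shat u + c0)) *
      Real.exp (-(∫ m in u..s,
        (lam + 2 * (Shat m + c0) / σS - (Shat m + c0) / σS ^ 2))) := by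
    have := continuous_integral_lower hq s
    fun_prop
  refine ⟨by simp [hB, hl], fun t => ?_⟩
  have hexp : Real.exp (-2 * ∫ u in t..s, (lam + (Shat u + c0) / σS)) =
      Real.exp (-(∫ m in t..s,
        (lam + 2 * (Shat m + c0) / σS - (Shat m + c0) / σS ^ 2))) *
      Real.exp (-(∫ u in t..s, (lam + (Shat u + c0) / σS ^ 2))) := by
    rw [← Real.exp_add, ← neg_add, ← intervalIntegral.integral_add
      (hq.intervalIntegrable t s) (hp.intervalIntegrable t s), neg_mul,
      ← intervalIntegral.integral_const_mul]
    congr 3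
    ext u
    ring
  have hderiv := ((hasDerivAt_integral_lower hg s t).const_mul (-(1 / σS ^ 2))).mul
    (hasDerivAt_integral_lower hp s t).neg.exp
  have hBfun : B = _ := funext fun x => (hB x).trans (by rw [hl x])
  rw [hBfun]
  refine hderiv.congr_deriv ?_
  simp only [hA, hexp, Pi.neg_apply]
  field_simp
  ring
end

section
/- Fix σ_S > 0, real constants λ, σ_μ, ρ, μ̄, w₂, continuous functions Σ̂, α : ℝ → ℝ, and s ∈ ℝ; write c₀ = σ_Sσ_μρ. Let A(t, s) and B(t, s) be the explicit expressions A(t, s) = −(1/(2σ_S²)) exp(−2∫ₜˢ (λ + (Σ̂(u)+c₀)/σ_S) du) and B(t, s) = l(t, s) exp(−∫ₜˢ (λ + (Σ̂(u)+c₀)/σ_S²) du) with l(t, s) = −(1/σ_S²)∫ₜˢ (λμ̄ + w₂α(u)(Σ̂(u)+c₀)) exp(−∫ᵤˢ (λ + 2(Σ̂(m)+c₀)/σ_S − (Σ̂(m)+c₀)/σ_S²) dm) du, and define C(t, s) = ∫ₜˢ [((Σ̂(u)+c₀)²/σ_S²)·A(u, s) + (λμ̄ + w₂α(u)(Σ̂(u)+c₀))·B(u,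 s)] du. Then the triple (A, B, C) solves the terminal-value ODE system: ∂ₜA − 2λA − (2(Σ̂(t)+c₀)/σ_S)A = 0, ∂ₜB − λB − ((Σ̂(t)+c₀)/σ_S²)B + 2λμ̄A + 2w₂α(t)(Σ̂(t)+c₀)A = 0, ∂ₜC + ((Σ̂(t)+c₀)²/σ_S²)A + λμ̄B + w₂α(t)(Σ̂(t)+c₀)B = 0, with A(t, t) = −1/(2σ_S²) and B(t, t) = C(t, t) = 0. -/
/-- The derivative of the integral of a continuous function with respect to its lower endpoint. -/
theorem hasDerivAt_integral_left_of_continuous {f : ℝ → ℝ} (hf : Continuous f) (s t : ℝ) :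
    HasDerivAt (fun τ => ∫ u in τ..s, f u) (-f t) t :=
  intervalIntegral.integral_hasDerivAt_left (hf.intervalIntegrable _ _)
    (hf.stronglyMeasurableAtFilter _ _) hf.continuousAt

/-- An integral of a continuous function depends continuously on its lower endpoint. -/
theorem continuous_integral_left_of_continuous {f : ℝ → ℝ} (hf : Continuous f) (s : ℝ) :
    Continuous (fun τ => ∫ u in τ..s, f u) :=
  continuous_iff_continuousAt.2 fun t =>
    (hasDerivAt_integral_left_of_continuous hf s t).continuousAt


/-- The triple `(A, B, C)` of explicit expressions solves the
terminal-value ODE system of the quadratic ansatz: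
`∂ₜA - 2λA - (2(Σ̂(t)+c₀)/σ_S)A = 0`,
`∂ₜB - λB - ((Σ̂(t)+c₀)/σ_S²)B + 2λμ̄A + 2w₂α(t)(Σ̂(t)+c₀)A = 0`,
`∂ₜC + ((Σ̂(t)+c₀)²/σ_S²)A + λμ̄B + w₂α(t)(Σ̂(t)+c₀)B = 0`,
with `A(t,t) = -1/(2σ_S²)`, `B(t,t) = C(t,t) = 0`. -/
theorem stmt_6 (σS lam σμ ρ mubar w2 : ℝ) (hσS : 0 < σS)
    (Shat α : ℝ → ℝ) (hShat : Continuous Shat) (hα : Continuous α)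
    (c0 : ℝ) (hc0 : c0 = σS * σμ * ρ)
    (A l B C : ℝ → ℝ → ℝ)
    (hA : ∀ t s, A t s = -(1 / (2 * σS ^ 2)) *
        Real.exp (-2 * ∫ u in t..s, (lam + (Shat u + c0) / σS)))
    (hl : ∀ t s, l t s = -(1 / σS ^ 2) * ∫ u in t..s,
        (lam * mubar + w2 * α u * (Shat u + c0)) *
          Real.exp (-(∫ m in u..s,
            (lam + 2 * (Shat m + c0) / σS - (Shat m + c0) / σS ^ 2))))
    (hB : ∀ t s, B t s = l t s *
        Real.exp (-(∫ u in t..s, (lam + (Shat u + c0) / σS ^ 2))))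
    (hC : ∀ t s, C t s = ∫ u in t..s,
        (((Shat u + c0) ^ 2 / σS ^ 2) * A u s +
          (lam * mubar + w2 * α u * (Shat u + c0)) * B u s)) :
    (∀ s t : ℝ, HasDerivAt (fun τ => A τ s)
      (2 * lam * A t s + (2 * (Shat t + c0) / σS) * A t s) t) ∧
    (∀ s t : ℝ, HasDerivAt (fun τ => B τ s)
      (lam * B t s + ((Shat t + c0) / σS ^ 2) * B t s - 2 * lam * mubar * A t s
        - 2 * w2 * α t * (Shat t + c0) * A t s) t) ∧
    (∀ s t : ℝ, HasDerivAt (fun τ => C τ s)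
      (-(((Shat t + c0) ^ 2 / σS ^ 2) * A t s) - lam * mubar * B t s
        - w2 * α t * (Shat t + c0) * B t s) t) ∧
    (∀ t : ℝ, A t t = -(1 / (2 * σS ^ 2))) ∧
    (∀ t : ℝ, B t t = 0) ∧
    (∀ t : ℝ, C t t = 0) := by
  have hσ : σS ≠ 0 := hσS.ne'
  have hf : Continuous fun u => lam + (Shat u + c0) / σS := by fun_prop
  have hk : Continuous fun u => lam + (Shat u + c0) / σS ^ 2 := by fun_prop
  have hh : Continuous fun u =>
      lam + 2 * (Shat u + c0) / σS - (Shat u + c0) / σS ^ 2 := by fun_prop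
  have hg : Continuous fun u => lam * mubar + w2 * α u * (Shat u + c0) := by fun_prop
  have hA' : ∀ s t : ℝ, HasDerivAt (fun τ => A τ s)
      (2 * lam * A t s + (2 * (Shat t + c0) / σS) * A t s) t := by
    intro s t
    simp only [hA]
    refine ((((hasDerivAt_integral_left_of_continuous hf s t).const_mul (-2)).exp).const_mul
      (-(1 / (2 * σS ^ 2)))).congr_deriv ?_
    ring
  have hprod : ∀ s t : ℝ,
      Real.exp (-(∫ m in t..s, (lam + 2 * (Shat m + c0) / σS - (Shat m + c0) / σS ^ 2))) *
        Real.exp (-(∫ u in t..s, (lam + (Shat u + c0) / σS ^ 2))) = -2 * σS ^ 2 * A t s := by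
    intro s t
    have hsum : (∫ m in t..s, (lam + 2 * (Shat m + c0) / σS - (Shat m + c0) / σS ^ 2)) +
        (∫ u in t..s, (lam + (Shat u + c0) / σS ^ 2)) =
        2 * ∫ u in t..s, (lam + (Shat u + c0) / σS) := by
      rw [← intervalIntegral.integral_add (hh.intervalIntegrable _ _)
        (hk.intervalIntegrable _ _), ← intervalIntegral.integral_const_mul]
      congr 1
      ext u
      ring
    rw [hA, ← Real.exp_add, ← neg_add, hsum, ← neg_mul]
    field_simp
  have hB' : ∀ s t : ℝ, HasDerivAt (fun τ => B τ s)
      (lam * B t s + ((Shat t + c0) / σS ^ 2) * B t s - 2 * lam * mubar * A t s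
        - 2 * w2 * α t * (Shat t + c0) * A t s) t := by
    intro s t
    have hl' : HasDerivAt (fun τ => l τ s)
        (-(1 / σS ^ 2) * -((lam * mubar + w2 * α t * (Shat t + c0)) * Real.exp (-(∫ m in t..s,
          (lam + 2 * (Shat m + c0) / σS - (Shat m + c0) / σS ^ 2))))) t := by
      simp only [hl]
      exact (hasDerivAt_integral_left_of_continuous
        (hg.mul (continuous_integral_left_of_continuous hh s).neg.rexp) s t).const_mul
        (-(1 / σS ^ 2))
    have hE : HasDerivAt (fun τ => Real.exp (-(∫ u in τ..s, (lam + (Shat u + c0) / σS ^ 2))))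
        (Real.exp (-(∫ u in t..s, (lam + (Shat u + c0) / σS ^ 2))) *
          (lam + (Shat t + c0) / σS ^ 2)) t := by
      simpa using (hasDerivAt_integral_left_of_continuous hk s t).neg.exp
    rw [show (fun τ => B τ s) = _ from funext fun τ => hB τ s]
    refine (hl'.mul hE).congr_deriv ?_
    rw [hB t s]
    have hA_eq : A t s = -(1 / (2 * σS ^ 2)) * (-2 * σS ^ 2 * A t s) := by field_simp
    rw [hA_eq, ← hprod s t]
    ring
  have hAcont : ∀ s, Continuous fun u => A u s := fun s =>
    continuous_iff_continuousAt.2 fun t => (hA' s t).continuousAt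
  have hBcont : ∀ s, Continuous fun u => B u s := fun s =>
    continuous_iff_continuousAt.2 fun t => (hB' s t).continuousAt
  refine ⟨hA', hB', fun s t => ?_, fun t => by simp [hA], fun t => by simp [hB, hl],
    fun t => by simp [hC]⟩
  have hAs := hAcont s
  have hBs := hBcont s
  have hcont : Continuous fun u => ((Shat u + c0) ^ 2 / σS ^ 2) * A u s +
      (lam * mubar + w2 * α u * (Shat u + c0)) * B u s := by fun_prop
  simp only [hC]
  refine (hasDerivAt_integral_left_of_continuous hcont s t).congr_deriv ?_
  ring
end

section
/- Let (Ω, 𝒜, ℙ) be a probability space, T > 0, ε > 0, and let h : [0, T] × Ω → ℝᵈ be jointly measurable. For each t ∈ [0, T] let 𝒢_t ⊆ 𝒜 be a sub-σ-algebra and let ĥ_t be a version of the conditional expectation 𝔼[h_t | 𝒢_t] (componentwise), chosen so that (t, ω) ↦ ĥ_t(ω) is jointly measurable. Assume that for each t the random variable exp((T/(2ε))‖h_t‖²) is integrable and that t ↦ 𝔼[exp((T/(2ε))‖h_t‖²)] is integrable on [0, T], and that h_t is integrable for each t. Then 𝔼[exp((1/(2ε)) ∫₀ᵀ ‖ĥ_t‖²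 dt)] ≤ (1/T) ∫₀ᵀ 𝔼[exp((T/(2ε))‖h_t‖²)] dt. -/
open MeasureTheory

/-- For `0 ≤ c`, the map `x ↦ exp (c * ‖x‖ ^ 2)` is convex. -/
lemma convexOn_exp_mul_norm_sq {E : Type*} [SeminormedAddCommGroup E] [NormedSpace ℝ E] {c : ℝ}
    (hc : 0 ≤ c) : ConvexOn ℝ Set.univ fun x : E => Real.exp (c * ‖x‖ ^ 2) := by
  have hsq : ConvexOn ℝ Set.univ fun x : E => c * ‖x‖ ^ 2 :=
    (convexOn_univ_norm.pow (fun _ _ => norm_nonneg _) 2).smul hc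
  refine ⟨convex_univ, fun x hx y hy a b ha hb hab => ?_⟩
  exact (Real.exp_le_exp.2 (hsq.2 hx hy ha hb hab)).trans
    (convexOn_exp.2 (Set.mem_univ _) (Set.mem_univ _) ha hb hab)

/-- A function that is coordinatewise the conditional expectation of `f` is the conditional
expectation of `f`. -/
lemma ae_eq_condExp_of_forall_apply {Ω ι : Type*} [Fintype ι] {m m0 : MeasurableSpace Ω}
    {μ : Measure Ω} {f g : Ω → EuclideanSpace ℝ ι} (hf : Integrable f μ)
    (hg : ∀ i, (fun ω => g ω i) =ᵐ[μ] μ[fun ω => f ω i | m]) : g =ᵐ[μ] μ[f | m] := by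
  have hcoord : ∀ i, ∀ᵐ ω ∂μ, μ[f | m] ω i = μ[fun ω => f ω i | m] ω := fun i =>
    (EuclideanSpace.proj (𝕜 := ℝ) i).comp_condExp_comm hf
  filter_upwards [ae_all_iff.2 hg, ae_all_iff.2 hcoord] with ω h₁ h₂
  ext i
  rw [h₂ i, ← h₁ i]

/-- Conditional expectation does not increase exponential-quadratic moments. -/
lemma integrable_and_integral_exp_mul_norm_sq_condExp_le {Ω E : Type*} [NormedAddCommGroup E]
    [NormedSpace ℝ E] [CompleteSpace E] {m m0 : MeasurableSpace Ω} {μ : Measure Ω}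
    (hm : m ≤ m0) [SigmaFinite (μ.trim hm)] {f : Ω → E} {c : ℝ} (hc : 0 ≤ c)
    (hf : Integrable f μ) (hexp : Integrable (fun ω => Real.exp (c * ‖f ω‖ ^ 2)) μ) :
    Integrable (fun ω => Real.exp (c * ‖μ[f | m] ω‖ ^ 2)) μ ∧
      ∫ ω, Real.exp (c * ‖μ[f | m] ω‖ ^ 2) ∂μ ≤ ∫ ω, Real.exp (c * ‖f ω‖ ^ 2) ∂μ := by
  have hcont : Continuous fun x : E => Real.exp (c * ‖x‖ ^ 2) := by fun_prop
  have hle : ∀ᵐ ω ∂μ, Real.exp (c * ‖μ[f | m] ω‖ ^ 2) ≤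
      μ[fun ω => Real.exp (c * ‖f ω‖ ^ 2) | m] ω :=
    (convexOn_exp_mul_norm_sq hc).map_condExp_le_univ hm hcont.lowerSemicontinuous hf hexp
  have hint : Integrable (fun ω => Real.exp (c * ‖μ[f | m] ω‖ ^ 2)) μ := by
    refine (integrable_condExp (m := m) (f := fun ω => Real.exp (c * ‖f ω‖ ^ 2))).mono'
      (hcont.comp_aestronglyMeasurable integrable_condExp.aestronglyMeasurable) ?_
    filter_upwards [hle] with ω hω
    rwa [Real.norm_of_nonneg (Real.exp_nonneg _)]
  exact ⟨hint, (integral_mono_ae hint integrable_condExp hle).trans_eq (integral_condExp hm)⟩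

/-- Jensen's inequality for the exponential of a time integral over `[0, T]`. -/
lemma exp_intervalIntegral_le {T : ℝ} (hT : 0 < T) {g : ℝ → ℝ}
    (hg : IntervalIntegrable g volume 0 T)
    (hexp : IntervalIntegrable (fun t => Real.exp (T * g t)) volume 0 T) :
    Real.exp (∫ t in (0 : ℝ)..T, g t) ≤ (1 / T) * ∫ t in (0 : ℝ)..T, Real.exp (T * g t) := by
  rw [intervalIntegrable_iff_integrableOn_Ioc_of_le hT.le] at hg hexp
  have key := convexOn_exp.map_set_average_le (μ := volume) (t := Set.Ioc 0 T)
    (f := fun t => T * g t) Real.continuous_exp.continuousOn isClosed_univ (by simp [hT]) (by simp)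
    (by simp) (hg.const_mul T) hexp
  simp only [setAverage_eq, integral_const_mul, Measure.real, Real.volume_Ioc, sub_zero,
    ENNReal.toReal_ofReal hT.le, smul_eq_mul, inv_mul_cancel_left₀ hT.ne'] at key
  simpa only [intervalIntegral.integral_of_le hT.le, one_div] using key

/-- Jensen's inequality for the filtered return process:
`𝔼[exp((1/(2ε))∫₀ᵀ ‖ĥ_t‖² dt)] ≤ (1/T)∫₀ᵀ 𝔼[exp((T/(2ε))‖h_t‖²)] dt`, where
`ĥ_t` is (a jointly measurable version of) the componentwise conditional expectation
`𝔼[h_t | 𝒢_t]`. -/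
theorem stmt_14 {Ω : Type*} {m0 : MeasurableSpace Ω} (μ : Measure Ω)
    [IsProbabilityMeasure μ] (d : ℕ) (T ε : ℝ) (hT : 0 < T) (hε : 0 < ε)
    (h hhat : ℝ → Ω → EuclideanSpace ℝ (Fin d))
    (𝒢 : ℝ → MeasurableSpace Ω) (h𝒢 : ∀ t, 𝒢 t ≤ m0)
    (hmeas : Measurable (fun p : ℝ × Ω => h p.1 p.2))
    (hhatmeas : Measurable (fun p : ℝ × Ω => hhat p.1 p.2))
    (hcond : ∀ t, ∀ i : Fin d,
      (fun ω => hhat t ω i) =ᵐ[μ] μ[fun ω => h t ω i | 𝒢 t])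
    (hint : ∀ t, Integrable (h t) μ)
    (hexpint : ∀ t, Integrable (fun ω => Real.exp ((T / (2 * ε)) * ‖h t ω‖ ^ 2)) μ)
    (hexpint2 : IntegrableOn
      (fun t => ∫ ω, Real.exp ((T / (2 * ε)) * ‖h t ω‖ ^ 2) ∂μ) (Set.Icc 0 T)) :
    ∫ ω, Real.exp ((1 / (2 * ε)) * ∫ t in (0 : ℝ)..T, ‖hhat t ω‖ ^ 2) ∂μ ≤
      (1 / T) * ∫ t in (0 : ℝ)..T, ∫ ω, Real.exp ((T / (2 * ε)) * ‖h t ω‖ ^ 2) ∂μ := by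
  have hc : 0 < T / (2 * ε) := by positivity
  have hjensen : ∀ t, Integrable (fun ω => Real.exp ((T / (2 * ε)) * ‖hhat t ω‖ ^ 2)) μ ∧
      ∫ ω, Real.exp ((T / (2 * ε)) * ‖hhat t ω‖ ^ 2) ∂μ ≤
        ∫ ω, Real.exp ((T / (2 * ε)) * ‖h t ω‖ ^ 2) ∂μ := fun t => by
    have hae : (fun ω => Real.exp ((T / (2 * ε)) * ‖hhat t ω‖ ^ 2)) =ᵐ[μ]
        fun ω => Real.exp ((T / (2 * ε)) * ‖μ[h t | 𝒢 t] ω‖ ^ 2) :=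
      (ae_eq_condExp_of_forall_apply (hint t) (hcond t)).fun_comp
        fun x => Real.exp ((T / (2 * ε)) * ‖x‖ ^ 2)
    rw [integrable_congr hae, integral_congr_ae hae]
    exact integrable_and_integral_exp_mul_norm_sq_condExp_le (h𝒢 t) hc.le (hint t) (hexpint t)
  have hright : IntegrableOn
      (fun t => ∫ ω, Real.exp ((T / (2 * ε)) * ‖h t ω‖ ^ 2) ∂μ) (Set.Ioc 0 T) :=
    hexpint2.mono_set Set.Ioc_subset_Icc_self
  have hFmeas : Measurable fun p : ℝ × Ω => Real.exp ((T / (2 * ε)) * ‖hhat p.1 p.2‖ ^ 2) := by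
    fun_prop
  have hleft : IntegrableOn
      (fun t => ∫ ω, Real.exp ((T / (2 * ε)) * ‖hhat t ω‖ ^ 2) ∂μ) (Set.Ioc 0 T) := by
    refine hright.mono' hFmeas.stronglyMeasurable.integral_prod_right'.aestronglyMeasurable
      (.of_forall fun t => ?_)
    rw [Real.norm_of_nonneg (integral_nonneg fun _ => Real.exp_nonneg _)]
    exact (hjensen t).2
  have hprod : Integrable (fun p : ℝ × Ω => Real.exp ((T / (2 * ε)) * ‖hhat p.1 p.2‖ ^ 2))
      ((volume.restrict (Set.Ioc 0 T)).prod μ) := by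
    rw [integrable_prod_iff hFmeas.aestronglyMeasurable]
    refine ⟨.of_forall fun t => (hjensen t).1, ?_⟩
    simpa only [Real.norm_of_nonneg (Real.exp_nonneg _), IntegrableOn] using hleft
  have hpath : ∀ᵐ ω ∂μ,
      Real.exp ((1 / (2 * ε)) * ∫ t in (0 : ℝ)..T, ‖hhat t ω‖ ^ 2) ≤
        (1 / T) * ∫ t in Set.Ioc 0 T, Real.exp ((T / (2 * ε)) * ‖hhat t ω‖ ^ 2) := by
    filter_upwards [hprod.prod_left_ae] with ω hω
    have hscale : ∀ t, (T / (2 * ε)) * ‖hhat t ω‖ ^ 2 = T * ((1 / (2 * ε)) * ‖hhat t ω‖ ^ 2) :=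
      fun t => by ring
    have hsq : IntegrableOn (fun t => (T / (2 * ε)) * ‖hhat t ω‖ ^ 2) (Set.Ioc 0 T) := by
      have hmeas_path : Measurable fun t => (T / (2 * ε)) * ‖hhat t ω‖ ^ 2 :=
        ((hhatmeas.comp measurable_prodMk_right).norm.pow_const 2).const_mul _
      refine hω.mono' hmeas_path.aestronglyMeasurable (.of_forall fun t => ?_)
      rw [Real.norm_of_nonneg (by positivity)]
      exact (lt_add_one _).le.trans (Real.add_one_le_exp _)
    simp only [hscale] at hω hsq ⊢
    have hsq' : IntegrableOn (fun t => (1 / (2 * ε)) * ‖hhat t ω‖ ^ 2) (Set.Ioc 0 T) := by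
      simpa only [inv_mul_cancel_left₀ hT.ne', IntegrableOn] using hsq.const_mul T⁻¹
    rw [← intervalIntegral.integral_const_mul, ← intervalIntegral.integral_of_le hT.le]
    exact exp_intervalIntegral_le hT
      ((intervalIntegrable_iff_integrableOn_Ioc_of_le hT.le).2 hsq')
      ((intervalIntegrable_iff_integrableOn_Ioc_of_le hT.le).2 hω)
  calc
    _ ≤ ∫ ω, (1 / T) * (∫ t in Set.Ioc 0 T, Real.exp ((T / (2 * ε)) * ‖hhat t ω‖ ^ 2)) ∂μ :=
      integral_mono_of_nonneg (.of_forall fun _ => Real.exp_nonneg _)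
        (hprod.integral_prod_right.const_mul _) hpath
    _ = (1 / T) * ∫ t in Set.Ioc 0 T, ∫ ω, Real.exp ((T / (2 * ε)) * ‖hhat t ω‖ ^ 2) ∂μ := by
      rw [integral_const_mul, integral_integral_swap
        (f := fun ω t => Real.exp ((T / (2 * ε)) * ‖hhat t ω‖ ^ 2)) hprod.swap]
    _ ≤ _ := by
      rw [intervalIntegral.integral_of_le hT.le]
      exact mul_le_mul_of_nonneg_left
        (integral_mono hleft hright fun t => (hjensen t).2) (by positivity)
end
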